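/- Pointwise annuli picking (Claim D.2). Let M be a metric space, let p ∈ M be a fixed point, and let L be a positive integer. Let P_1, P_2, P_3, … be sub-collections of the set of all annuli of M centered at p (each P_k encoded as a predicate on pairs of radii (s, r) with 0 < s < r) satisfying: (i) each P_k is closed under concentric sub-annuli, i.e. if (p, s, r) ∈ P_k and s ≤ s' < r' ≤ r then (p, s', r') ∈ P_k; and (ii) for every k, every L-admissible collection of annuli centered at p contains at least one annulus belonging to P_k. Then there exist a strictly increasing sequence of indices k_1 < k_2 < k_3 < … and a real number δ_p > 0 such that for all s, r with 0 < s < r < δ_p, the annulus An(p; s, r) belongs to P_{k_j} for all sufficiently large j. -/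

import Mathlib

/-- If along every subsequence and at every scale some annulus is frequently excluded by `P`, then
along a further subsequence `n` successively nested annuli are excluded simultaneously. -/
theorem exists_strictMono_forall_not_annuli {P : ℕ → ℝ → ℝ → Prop}
    (hP : ∀ k : ℕ → ℕ, StrictMono k → ∀ δ : ℝ, 0 < δ →
      ∃ s r : ℝ, 0 < s ∧ s < r ∧ r < δ ∧ ∃ᶠ j in Filter.atTop, ¬ P (k j) s r) (n : ℕ) :
    ∀ k : ℕ → ℕ, StrictMono k → ∀ δ : ℝ, 0 < δ →
      ∃ φ : ℕ → ℕ, StrictMono φ ∧ ∃ s r : ℕ → ℝ,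
        (∀ i < n, 0 < s i ∧ s i < r i ∧ 2 * r i < δ) ∧
        (∀ i, i + 1 < n → 2 * r (i + 1) < s i) ∧
        ∀ i < n, ∀ j, ¬ P (k (φ j)) (s i) (r i) := by
  induction n with
  | zero =>
    intro k _ δ _
    exact ⟨id, strictMono_id, 0, 0, by simp, by simp, by simp⟩
  | succ n ih =>
    intro k hk δ hδ
    obtain ⟨s₀, r₀, hs₀, hsr₀, hr₀, hfreq⟩ := hP k hk (δ / 2) (half_pos hδ)
    obtain ⟨φ, hφ, hbad₀⟩ := Filter.extraction_of_frequently_atTop hfreq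
    obtain ⟨ψ, hψ, s, r, hsr, hgap, hbad⟩ := ih (k ∘ φ) (hk.comp hφ) s₀ hs₀
    refine ⟨φ ∘ ψ, hφ.comp hψ, fun i => Nat.casesOn i s₀ s, fun i => Nat.casesOn i r₀ r,
      ?_, ?_, ?_⟩
    · rintro (_ | i) hi
      · exact ⟨hs₀, hsr₀, (by linarith : 2 * r₀ < δ)⟩
      · obtain ⟨h₁, h₂, h₃⟩ := hsr i (by omega)
        exact ⟨h₁, h₂, (by linarith : 2 * r i < δ)⟩
    · rintro (_ | i) hi
      · exact (hsr 0 (by omega)).2.2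
      · exact hgap i (by omega)
    · rintro (_ | i) hi j
      · exact hbad₀ (ψ j)
      · exact hbad i (by omega) j


/-- **Pointwise annuli picking (Claim D.2).**
Let `M` be a metric space, `p ∈ M` a fixed point, `L` a positive integer, and `P k`
a family of sub-collections of annuli centered at `p` (encoded as predicates on pairs
of radii `(s, r)`). Assume each `P k` is closed under concentric sub-annuli and that
every `L`-admissible collection of annuli centered at `p` contains at least one
annulus belonging to `P k`. Then there exist a subsequence `k₁ < k₂ < ⋯` and `δ_p > 0`
such that for all `0 < s < r < δ_p`, the annulus `An(p; s, r)` belongs to `P (k j)`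
for all sufficiently large `j`. -/
theorem pointwise_annuli_picking
    {M : Type*} [MetricSpace M] (p : M)
    (L : ℕ) (hL : 0 < L)
    (P : ℕ → ℝ → ℝ → Prop)
    (hsub : ∀ (k : ℕ) (s r s' r' : ℝ),
      P k s r → s ≤ s' → s' < r' → r' ≤ r → P k s' r')
    (hadm : ∀ (k : ℕ) (s r : Fin L → ℝ),
      (∀ j, 0 < s j ∧ s j < r j) →
      (∀ (j : ℕ) (hj : j + 1 < L), 2 * r ⟨j + 1, hj⟩ < s ⟨j, Nat.lt_of_succ_lt hj⟩) →
      ∃ j, P k (s j) (r j)) :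
    ∃ k : ℕ → ℕ, StrictMono k ∧
      ∃ δ : ℝ, 0 < δ ∧
        ∀ s r : ℝ, 0 < s → s < r → r < δ →
          ∃ J : ℕ, ∀ j ≥ J, P (k j) s r := by
  by_contra! hcon
  obtain ⟨φ, -, s, r, hsr, hgap, hbad⟩ := exists_strictMono_forall_not_annuli (P := P)
    (fun k hk δ hδ => by
      obtain ⟨s, r, hs, hlt, hr, h⟩ := hcon k hk δ hδ
      exact ⟨s, r, hs, hlt, hr, Filter.frequently_atTop.2 h⟩) L id strictMono_id 1 one_pos
  obtain ⟨j, hj⟩ := hadm (φ 0) (fun i => s i) (fun i => r i)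
    (fun i => ⟨(hsr i i.2).1, (hsr i i.2).2.1⟩) (fun i hi => hgap i hi)
  exact hbad j j.2 0 hj
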